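/- Let D be an n-atomic domain satisfying Condition (*). If for every x ∈ D^# every finite set of pairwise nonassociate irreducible divisors of x is a face of S(x) (i.e., the face set of S(x) is the full power set of its vertex set), then D is an n-UFD. -/

import Mathlib

/-- `a` is a nonzero nonunit (membership in `D^#`). -/
def NNU {D : Type*} [Ring D] (a : D) : Prop := a ≠ 0 ∧ ¬ IsUnit a

/-- `a ∣ b` in the sense of the paper: `b = c * a * d` for some `c, d`. -/
def PDvd {D : Type*} [Ring D] (a b : D) : Prop := ∃ c d : D, b = c * a * d

/-- `a ~ b`: `a = u * b * v` for units `u, v`. -/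
def PAssoc {D : Type*} [Ring D] (a b : D) : Prop :=
  ∃ u v : Dˣ, a = (u : D) * b * (v : D)

/-- `a` is irreducible: a nonzero nonunit that is not a product of two nonunits. -/
def PIrred {D : Type*} [Ring D] (a : D) : Prop :=
  NNU a ∧ ∀ y z : D, a = y * z → IsUnit y ∨ IsUnit z

/-- `a` is normal: `aD = Da`. -/
def PNormal {D : Type*} [Ring D] (a : D) : Prop :=
  {x : D | ∃ d : D, x = a * d} = {x : D | ∃ d : D, x = d * a}
/-- `D` is n-atomic: every nonzero nonunit is a product of normal irreducible elements. -/
def NAtomic (D : Type*) [Ring D] : Prop :=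
  ∀ a : D, NNU a → ∃ l : List D, l ≠ [] ∧ (∀ p ∈ l, PNormal p ∧ PIrred p) ∧ a = l.prod

/-- A factorization of `r` into normal irreducible elements. -/
def NFactorization {D : Type*} [Ring D] (r : D) (l : List D) : Prop :=
  (∀ p ∈ l, PNormal p ∧ PIrred p) ∧ r = l.prod

/-- `D` is an n-UFD: n-atomic, and factorizations into normal irreducibles are
unique up to order and associates. -/
def NUFD (D : Type*) [Ring D] : Prop :=
  NAtomic D ∧ ∀ r : D, NNU r → ∀ l t : List D, NFactorization r l → NFactorization r t →
    ∃ σ : Fin l.length ≃ Fin t.length, ∀ i, PAssoc (l.get i) (t.get (σ i))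
/-- `A` is a face of the irreducible divisor simplicial complex `S x`:
a finite set of pairwise nonassociate irreducible divisors of `x`, some ordering
of which has product dividing `x`. -/
def IsFace {D : Type*} [Ring D] (x : D) (A : Finset D) : Prop :=
  (∀ a ∈ A, PIrred a ∧ PDvd a x) ∧
  (∀ a ∈ A, ∀ b ∈ A, a ≠ b → ¬ PAssoc a b) ∧
  ∃ l : List D, l.Nodup ∧ (∀ a : D, a ∈ l ↔ a ∈ A) ∧ PDvd l.prod x

/-- Condition (*): whenever `a, r, r'` are normal irreducible elements with
`a * r = r' * a`, then `r ~ r'`. -/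
def CondStar (D : Type*) [Ring D] : Prop :=
  ∀ a r r' : D, PNormal a → PIrred a → PNormal r → PIrred r →
    PNormal r' → PIrred r' → a * r = r' * a → PAssoc r r'

theorem List.exists_equiv_get_cons {α : Type*} {R : α → α → Prop} {a b : α} {l t : List α}
    (hab : R a b) (h : ∃ σ : Fin l.length ≃ Fin t.length, ∀ i, R (l.get i) (t.get (σ i))) :
    ∃ σ : Fin (a :: l).length ≃ Fin (b :: t).length,
      ∀ i, R ((a :: l).get i) ((b :: t).get (σ i)) := by
  obtain ⟨σ, hσ⟩ := h
  refine ⟨((finSuccEquiv l.length).trans (Equiv.optionCongr σ)).trans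
    (finSuccEquiv t.length).symm, fun i => ?_⟩
  refine Fin.cases ?_ (fun j => ?_) i
  · simpa using hab
  · simpa using hσ j

theorem List.Perm.exists_equiv_get {α : Type*} {l t : List α} (h : l.Perm t) :
    ∃ σ : Fin l.length ≃ Fin t.length, ∀ i, l.get i = t.get (σ i) := by
  induction h with
  | nil => exact ⟨Equiv.refl _, fun _ => rfl⟩
  | cons a _ ih => exact List.exists_equiv_get_cons (R := Eq) rfl ih
  | swap a b l =>
    refine ⟨Equiv.swap (0 : Fin (l.length + 2)) 1, fun i => ?_⟩
    refine Fin.cases ?_ (fun j => Fin.cases ?_ (fun k => ?_) j) i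
    · simp
    · simp
    · have hk : Equiv.swap (0 : Fin (l.length + 2)) 1 k.succ.succ = k.succ.succ :=
        Equiv.swap_apply_of_ne_of_ne (Fin.succ_ne_zero _)
          fun h => Fin.succ_ne_zero k (Fin.succ_injective _ h)
      rw [hk]
      rfl
  | trans _ _ ih₁ ih₂ =>
    obtain ⟨σ, hσ⟩ := ih₁
    obtain ⟨τ, hτ⟩ := ih₂
    exact ⟨σ.trans τ, fun i => (hσ i).trans (hτ _)⟩

section NormalDomain

variable {D : Type*} [Ring D]

theorem PNormal.exists_mul_eq_left {a : D} (ha : PNormal a) (d : D) : ∃ e, a * d = e * a := by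
  have h : a * d ∈ {x : D | ∃ d : D, x = d * a} := ha ▸ ⟨d, rfl⟩
  exact h

theorem PNormal.exists_mul_eq_right {a : D} (ha : PNormal a) (d : D) : ∃ e, d * a = a * e := by
  have h : d * a ∈ {x : D | ∃ d : D, x = a * d} := ha.symm ▸ ⟨d, rfl⟩
  exact h

theorem pNormal_iff {a : D} :
    PNormal a ↔ (∀ d, ∃ e, a * d = e * a) ∧ ∀ d, ∃ e, d * a = a * e := by
  refine ⟨fun h => ⟨h.exists_mul_eq_left, h.exists_mul_eq_right⟩, fun h => ?_⟩
  ext x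
  constructor
  · rintro ⟨d, rfl⟩
    exact h.1 d
  · rintro ⟨d, rfl⟩
    exact h.2 d

theorem pNormal_zero : PNormal (0 : D) := by
  simp [PNormal]

theorem IsUnit.pNormal {a : D} (ha : IsUnit a) : PNormal a := by
  obtain ⟨u, rfl⟩ := ha
  exact pNormal_iff.2 ⟨fun d => ⟨u * d * ↑u⁻¹, by simp [mul_assoc]⟩,
    fun d => ⟨↑u⁻¹ * d * u, by simp [mul_assoc]⟩⟩

theorem PNormal.mul {a b : D} (ha : PNormal a) (hb : PNormal b) : PNormal (a * b) := by
  refine pNormal_iff.2 ⟨fun d => ?_, fun d => ?_⟩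
  · obtain ⟨e, he⟩ := hb.exists_mul_eq_left d
    obtain ⟨f, hf⟩ := ha.exists_mul_eq_left e
    exact ⟨f, by rw [mul_assoc, he, ← mul_assoc, hf, mul_assoc]⟩
  · obtain ⟨e, he⟩ := ha.exists_mul_eq_right d
    obtain ⟨f, hf⟩ := hb.exists_mul_eq_right e
    exact ⟨f, by rw [← mul_assoc, he, mul_assoc, hf, mul_assoc]⟩

theorem pNormal_list_prod {l : List D} (hl : ∀ p ∈ l, PNormal p) : PNormal l.prod := by
  induction l with
  | nil => exact isUnit_one.pNormal
  | cons a l ih =>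
    rw [List.prod_cons]
    exact (hl a (by simp)).mul (ih fun p hp => hl p (List.mem_cons_of_mem _ hp))

theorem NAtomic.pNormal (h : NAtomic D) (a : D) : PNormal a := by
  by_cases h0 : a = 0
  · exact h0 ▸ pNormal_zero
  by_cases hu : IsUnit a
  · exact hu.pNormal
  obtain ⟨l, -, hl, rfl⟩ := h a ⟨h0, hu⟩
  exact pNormal_list_prod fun p hp => (hl p hp).1

theorem Associated.pAssoc {a b : D} (h : Associated a b) : PAssoc a b := by
  obtain ⟨u, rfl⟩ := h
  exact ⟨1, u⁻¹, by simp⟩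

theorem PDvd.exists_eq_mul (hN : ∀ a : D, PNormal a) {a b : D} (h : PDvd a b) :
    ∃ d, b = a * d := by
  obtain ⟨c, d, rfl⟩ := h
  obtain ⟨e, he⟩ := (hN a).exists_mul_eq_right c
  exact ⟨e * d, by rw [he, mul_assoc]⟩

variable [IsDomain D]

theorem isUnit_of_mul_eq_mul_of_isUnit {a y z : D} (ha0 : a ≠ 0) (ha : PNormal a)
    (h : y * a = a * z) (hz : IsUnit z) : IsUnit y := by
  obtain ⟨u, rfl⟩ := hz
  obtain ⟨s, hs⟩ := ha.exists_mul_eq_left ↑u⁻¹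
  have h1 : y * s * a = 1 * a := by
    rw [mul_assoc, ← hs, ← mul_assoc, h, mul_assoc, Units.mul_inv, one_mul, mul_one]
  exact IsUnit.of_mul_eq_one s (mul_right_cancel₀ ha0 h1)

theorem isUnit_of_mul_eq_mul_of_isUnit' {a y z : D} (ha0 : a ≠ 0) (ha : PNormal a)
    (h : y * a = a * z) (hy : IsUnit y) : IsUnit z := by
  obtain ⟨u, rfl⟩ := hy
  obtain ⟨s, hs⟩ := ha.exists_mul_eq_right ↑u⁻¹
  have h1 : a * (s * z) = a * 1 := by
    rw [← mul_assoc, ← hs, mul_assoc, ← h, ← mul_assoc, Units.inv_mul, one_mul, mul_one]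
  exact IsUnit.of_mul_eq_one_right s (mul_left_cancel₀ ha0 h1)

theorem PIrred.conj {a r r' : D} (ha0 : a ≠ 0) (ha : PNormal a) (hr : PIrred r)
    (h : a * r = r' * a) : PIrred r' := by
  refine ⟨⟨?_, fun hu => hr.1.2 (isUnit_of_mul_eq_mul_of_isUnit' ha0 ha h.symm hu)⟩, ?_⟩
  · rintro rfl
    exact hr.1.1 (by simpa [ha0] using h)
  · rintro y z rfl
    obtain ⟨z', hz⟩ := ha.exists_mul_eq_right z
    obtain ⟨y', hy⟩ := ha.exists_mul_eq_right y
    have h1 : r = y' * z' := by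
      apply mul_left_cancel₀ ha0
      rw [h, mul_assoc, hz, ← mul_assoc, hy, mul_assoc]
    exact (hr.2 y' z' h1).imp (isUnit_of_mul_eq_mul_of_isUnit ha0 ha hy)
      (isUnit_of_mul_eq_mul_of_isUnit ha0 ha hz)

theorem exists_unit_mul_eq (hN : ∀ a : D, PNormal a) (u : Dˣ) (b : D) :
    ∃ v : Dˣ, u * b = b * v := by
  by_cases hb : b = 0
  · exact ⟨1, by simp [hb]⟩
  obtain ⟨e, he⟩ := (hN b).exists_mul_eq_right u
  obtain ⟨v, rfl⟩ := isUnit_of_mul_eq_mul_of_isUnit' hb (hN b) he u.isUnit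
  exact ⟨v, he⟩

theorem PAssoc.associated (hN : ∀ a : D, PNormal a) {a b : D} (h : PAssoc a b) :
    Associated a b := by
  obtain ⟨u, v, rfl⟩ := h
  obtain ⟨w, hw⟩ := exists_unit_mul_eq hN u b
  refine Associated.symm ⟨w * v, ?_⟩
  rw [hw, Units.val_mul, mul_assoc]

theorem Associated.mul_of_pNormal (hN : ∀ a : D, PNormal a) {a b c d : D}
    (h : Associated a b) (h' : Associated c d) : Associated (a * c) (b * d) := by
  obtain ⟨u, rfl⟩ := h
  obtain ⟨v, rfl⟩ := h'
  obtain ⟨w, hw⟩ := exists_unit_mul_eq hN u c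
  refine ⟨w * v, ?_⟩
  rw [mul_assoc a (u : D), ← mul_assoc (u : D), hw, Units.val_mul]
  simp only [mul_assoc]

theorem CondStar.associated_mul_comm (hN : ∀ a : D, PNormal a) (hstar : CondStar D) {a r : D}
    (ha : PIrred a) (hr : PIrred r) : Associated (a * r) (r * a) := by
  obtain ⟨r', h⟩ := (hN a).exists_mul_eq_left r
  have h1 := hstar a r r' (hN a) ha (hN r) hr (hN r') (hr.conj ha.1.1 (hN a) h) h
  rw [h]
  exact (h1.associated hN).symm.mul_of_pNormal hN (Associated.refl a)

theorem CondStar.associated_prod_of_perm (hN : ∀ a : D, PNormal a) (hstar : CondStar D)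
    {l t : List D} (h : l.Perm t) (hl : ∀ p ∈ l, PIrred p) : Associated l.prod t.prod := by
  induction h with
  | nil => exact Associated.refl _
  | cons a _ ih =>
    simp only [List.prod_cons]
    exact (Associated.refl a).mul_of_pNormal hN (ih fun p hp => hl p (List.mem_cons_of_mem _ hp))
  | swap a b l =>
    simp only [List.prod_cons, ← mul_assoc]
    exact (hstar.associated_mul_comm hN (hl b (by simp)) (hl a (by simp))).mul_of_pNormal hN
      (Associated.refl _)
  | trans h₁ _ ih₁ ih₂ =>
    exact (ih₁ hl).trans (ih₂ fun p hp => hl p (h₁.mem_iff.2 hp))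

theorem PIrred.nnu_mul {a b : D} (ha : PIrred a) (hb : b ≠ 0) : NNU (a * b) := by
  refine ⟨mul_ne_zero ha.1.1 hb, fun hu => ha.1.2 ?_⟩
  obtain ⟨u, hu⟩ := hu
  exact IsUnit.of_mul_eq_one (b * ↑u⁻¹) (by rw [← mul_assoc, ← hu, Units.mul_inv])

theorem list_prod_ne_zero_of_pIrred {l : List D} (hl : ∀ p ∈ l, PIrred p) : l.prod ≠ 0 :=
  List.prod_ne_zero fun h => (hl 0 h).1.1 rfl

theorem exists_pAssoc_of_mul_eq_prod (hN : ∀ a : D, PNormal a) (hstar : CondStar D)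
    (hface : ∀ x : D, NNU x → ∀ A : Finset D, (∀ a ∈ A, PIrred a ∧ PDvd a x) →
      (∀ a ∈ A, ∀ b ∈ A, a ≠ b → ¬ PAssoc a b) → IsFace x A)
    {p : D} (hp : PIrred p) {l : List D} (hl : ∀ q ∈ l, PIrred q) {d : D}
    (h : l.prod = p * d) : ∃ q ∈ l, PAssoc p q := by
  classical
  induction l generalizing d with
  | nil => exact absurd (IsUnit.of_mul_eq_one d h.symm) hp.1.2
  | cons t l ih =>
    by_cases hpt : PAssoc p t
    · exact ⟨t, by simp, hpt⟩
    have ht : PIrred t := hl t (by simp)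
    have hl' : ∀ q ∈ l, PIrred q := fun q hq => hl q (List.mem_cons_of_mem _ hq)
    have hne : p ≠ t := fun e => hpt (e ▸ (Associated.refl p).pAssoc)
    have htp : ¬ PAssoc t p := fun e => hpt (e.associated hN).symm.pAssoc
    obtain ⟨-, -, m, hnd, hm, hdvd⟩ := hface (t :: l).prod
      (by rw [List.prod_cons]; exact ht.nnu_mul (list_prod_ne_zero_of_pIrred hl')) {p, t}
      (by
        simp only [Finset.mem_insert, Finset.mem_singleton, forall_eq_or_imp, forall_eq]
        exact ⟨⟨hp, 1, d, by rw [h, one_mul]⟩, ht, 1, l.prod, by rw [List.prod_cons, one_mul]⟩)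
      (by
        simp only [Finset.mem_insert, Finset.mem_singleton, forall_eq_or_imp, forall_eq]
        exact ⟨⟨fun e => absurd rfl e, fun _ => hpt⟩, fun _ => htp, fun e => absurd rfl e⟩)
    have hperm : m.Perm [t, p] := by
      rw [List.perm_ext_iff_of_nodup hnd (by simp [hne.symm])]
      intro a
      rw [hm]
      simp [or_comm]
    obtain ⟨u, hu⟩ := (hstar.associated_prod_of_perm hN hperm.symm (by simp [hp, ht]))
    obtain ⟨e, he⟩ := hdvd.exists_eq_mul hN
    obtain ⟨q, hq, hpq⟩ := ih hl' (d := u * e) (by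
      apply mul_left_cancel₀ ht.1.1
      rw [← List.prod_cons, he, ← hu]
      simp [mul_assoc])
    exact ⟨q, List.mem_cons_of_mem _ hq, hpq⟩

theorem exists_equiv_pAssoc_of_associated_prod (hN : ∀ a : D, PNormal a) (hstar : CondStar D)
    (hface : ∀ x : D, NNU x → ∀ A : Finset D, (∀ a ∈ A, PIrred a ∧ PDvd a x) →
      (∀ a ∈ A, ∀ b ∈ A, a ≠ b → ¬ PAssoc a b) → IsFace x A)
    {l t : List D} (hl : ∀ p ∈ l, PIrred p) (ht : ∀ p ∈ t, PIrred p)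
    (h : Associated l.prod t.prod) :
    ∃ σ : Fin l.length ≃ Fin t.length, ∀ i, PAssoc (l.get i) (t.get (σ i)) := by
  classical
  induction l generalizing t with
  | nil =>
    cases t with
    | nil => exact ⟨Equiv.refl _, fun i => i.elim0⟩
    | cons q t =>
      refine absurd (h.isUnit isUnit_one) ?_
      rw [List.prod_cons]
      exact ((ht q (by simp)).nnu_mul
        (list_prod_ne_zero_of_pIrred fun p hp => ht p (List.mem_cons_of_mem _ hp))).2
  | cons p l ih =>
    have hp : PIrred p := hl p (by simp)
    obtain ⟨u, hu⟩ := h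
    obtain ⟨q, hq, hpq⟩ := exists_pAssoc_of_mul_eq_prod hN hstar hface hp ht (d := l.prod * u)
      (by rw [← hu, List.prod_cons, mul_assoc])
    have hperm := List.perm_cons_erase hq
    have h1 : Associated (p * l.prod) (p * (t.erase q).prod) := by
      have h2 := hstar.associated_prod_of_perm hN hperm ht
      rw [← hu, List.prod_cons, List.prod_cons] at h2
      exact (Associated.trans ⟨u, rfl⟩ h2).trans
        ((hpq.associated hN).symm.mul_of_pNormal hN (Associated.refl _))
    obtain ⟨v, hv⟩ := h1
    have h3 : Associated l.prod (t.erase q).prod :=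
      ⟨v, mul_left_cancel₀ hp.1.1 (by rw [← mul_assoc, hv])⟩
    obtain ⟨σ, hσ⟩ := List.exists_equiv_get_cons hpq
      (ih (fun r hr => hl r (List.mem_cons_of_mem _ hr))
        (fun r hr => ht r (List.mem_of_mem_erase hr)) h3)
    obtain ⟨τ, hτ⟩ := hperm.symm.exists_equiv_get
    exact ⟨σ.trans τ, fun i => hτ (σ i) ▸ hσ i⟩

end NormalDomain

/-- If `D` is an n-atomic domain satisfying Condition (*) and for every
`x ∈ D^#` every finite set of pairwise nonassociate irreducible divisors of `x` is a
face of `S(x)`, then `D` is an n-UFD. -/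
theorem faces_powerset_implies_nufd {D : Type*} [Ring D] [IsDomain D]
    (hat : NAtomic D) (hstar : CondStar D)
    (hface : ∀ x : D, NNU x → ∀ A : Finset D, (∀ a ∈ A, PIrred a ∧ PDvd a x) →
      (∀ a ∈ A, ∀ b ∈ A, a ≠ b → ¬ PAssoc a b) → IsFace x A) :
    NUFD D :=
  ⟨hat, fun _ _ _ _ hl ht => exists_equiv_pAssoc_of_associated_prod hat.pNormal hstar hface
    (fun p hp => (hl.1 p hp).2) (fun p hp => (ht.1 p hp).2)
    (hl.2.symm.trans ht.2 ▸ Associated.refl _)⟩
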